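/- Let v be a square-integrable random vector in ℝ^m on a probability space with mean zero, E[v] = 0, and invertible second-moment matrix M = E[v vᵀ]. Let η ∈ ℝ^m, let ε be a random element of a measurable space that is independent of v, let g be a measurable function, set Y = g(⟨v, η⟩, ε), and let h be a measurable real-valued function with h(Y) square-integrable. Assume the linearity condition: there exist vectors a, b ∈ ℝ^m such that E[v | σ(⟨v, η⟩)] = a + ⟨v, η⟩ · b almost surely. Then there exists a constant κ ∈ ℝ such that M⁻¹ E[v · h(Y)] = κ · η; that is, the index vector η_h := M⁻¹ E[v · h(Y)] is proportional to η. -/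

import Mathlib

open MeasureTheory ProbabilityTheory Matrix

/-- A random variable with vanishing conditional expectation given `u` is orthogonal to every
measurable function of `u`. -/
theorem integral_mul_comp_eq_zero_of_condExp_eq_zero
    {Ω : Type*} [MeasurableSpace Ω] {μ : Measure Ω} [IsFiniteMeasure μ]
    {r u : Ω → ℝ} (hr : Integrable r μ) (hu : Measurable u)
    (hcond : μ[r | MeasurableSpace.comap u Real.measurableSpace] =ᵐ[μ] 0)
    {f : ℝ → ℝ} (hf : Measurable f) :
    ∫ ω, r ω * f (u ω) ∂μ = 0 := by
  by_cases hint : Integrable (fun ω => r ω * f (u ω)) μ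
  swap
  · exact integral_undef hint
  have hfu : StronglyMeasurable[MeasurableSpace.comap u Real.measurableSpace]
      (fun ω => f (u ω)) :=
    (hf.comp (comap_measurable u)).stronglyMeasurable
  have hpull := condExp_mul_of_stronglyMeasurable_right hfu hint hr
  rw [← integral_condExp hu.comap_le]
  refine integral_eq_zero_of_ae (hpull.trans ?_)
  filter_upwards [hcond] with ω hω
  simp [hω]

/-- A random variable with vanishing conditional expectation given `u` is orthogonal to every
measurable function of `u` and an independent noise. -/
theorem integral_mul_comp_noise_eq_zero_of_condExp_eq_zero
    {Ω E : Type*} [MeasurableSpace Ω] [MeasurableSpace E] {μ : Measure Ω} [IsProbabilityMeasure μ]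
    {r u : Ω → ℝ} (hr_meas : Measurable r) (hr : Integrable r μ) (hu : Measurable u)
    (hcond : μ[r | MeasurableSpace.comap u Real.measurableSpace] =ᵐ[μ] 0)
    {ε : Ω → E} (hε : Measurable ε) (hindep : IndepFun (fun ω => (r ω, u ω)) ε μ)
    {k : ℝ × E → ℝ} (hk : Measurable k) :
    ∫ ω, r ω * k (u ω, ε ω) ∂μ = 0 := by
  by_cases hint : Integrable (fun ω => r ω * k (u ω, ε ω)) μ
  swap
  · exact integral_undef hint
  have hru : Measurable fun ω => (r ω, u ω) := hr_meas.prodMk hu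
  have hF : Measurable fun p : (ℝ × ℝ) × E => p.1.1 * k (p.1.2, p.2) := by fun_prop
  have hlaw := (indepFun_iff_map_prod_eq_prod_map_map hru.aemeasurable hε.aemeasurable).1 hindep
  have : IsProbabilityMeasure (μ.map fun ω => (r ω, u ω)) :=
    Measure.isProbabilityMeasure_map hru.aemeasurable
  have : IsProbabilityMeasure (μ.map ε) := Measure.isProbabilityMeasure_map hε.aemeasurable
  have hint' : Integrable (fun p : (ℝ × ℝ) × E => p.1.1 * k (p.1.2, p.2))
      ((μ.map fun ω => (r ω, u ω)).prod (μ.map ε)) := by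
    rw [← hlaw]
    exact (integrable_map_measure hF.aestronglyMeasurable (hru.prodMk hε).aemeasurable).2 hint
  calc ∫ ω, r ω * k (u ω, ε ω) ∂μ
      = ∫ p, p.1.1 * k (p.1.2, p.2) ∂(μ.map fun ω => ((r ω, u ω), ε ω)) :=
        (integral_map (hru.prodMk hε).aemeasurable hF.aestronglyMeasurable).symm
    _ = ∫ e, ∫ p, p.1 * k (p.2, e) ∂(μ.map fun ω => (r ω, u ω)) ∂(μ.map ε) := by
        rw [hlaw, integral_prod_symm _ hint']
    _ = 0 := by
        refine integral_eq_zero_of_ae (Filter.Eventually.of_forall fun e => ?_)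
        have hFe : Measurable fun p : ℝ × ℝ => p.1 * k (p.2, e) := by fun_prop
        change ∫ p, p.1 * k (p.2, e) ∂(μ.map fun ω => (r ω, u ω)) = 0
        rw [integral_map hru.aemeasurable hFe.aestronglyMeasurable]
        exact integral_mul_comp_eq_zero_of_condExp_eq_zero hr hu hcond
          (f := fun t => k (t, e)) (by fun_prop)

/-- Proposition 1: under the linearity condition, the transformed-response
least-squares direction `η_h = M⁻¹ E[v ⬝ h(Y)]` is proportional to the
single-index direction `η`. -/
theorem linearity_condition_implies_proportional
    {Ω : Type*} [MeasurableSpace Ω] {μ : Measure Ω} [IsProbabilityMeasure μ]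
    {E : Type*} [MeasurableSpace E]
    {m : ℕ} (v : Ω → Fin m → ℝ) (hv_meas : Measurable v)
    (hv_L2 : ∀ j, MemLp (fun ω => v ω j) 2 μ)
    (hv_mean : ∀ j, ∫ ω, v ω j ∂μ = 0)
    (M : Matrix (Fin m) (Fin m) ℝ)
    (hM : M = Matrix.of fun i j => ∫ ω, v ω i * v ω j ∂μ)
    (hM_inv : IsUnit M.det)
    (η : Fin m → ℝ)
    (ε : Ω → E) (hε_meas : Measurable ε)
    (hindep : IndepFun v ε μ)
    (g : ℝ → E → ℝ) (hg : Measurable (Function.uncurry g))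
    (Y : Ω → ℝ) (hY : Y = fun ω => g (v ω ⬝ᵥ η) (ε ω))
    (h : ℝ → ℝ) (hh : Measurable h)
    (hhY : MemLp (fun ω => h (Y ω)) 2 μ)
    (a b : Fin m → ℝ)
    (hlin : ∀ j, (μ[(fun ω => v ω j) |
        MeasurableSpace.comap (fun ω => v ω ⬝ᵥ η) Real.measurableSpace])
        =ᵐ[μ] fun ω => a j + (v ω ⬝ᵥ η) * b j) :
    ∃ κ : ℝ, M⁻¹ *ᵥ (fun j => ∫ ω, v ω j * h (Y ω) ∂μ) = κ • η := by
  have hv_j : ∀ j, Measurable fun ω => v ω j := fun j => (measurable_pi_apply j).comp hv_meas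
  have hu : Measurable fun ω => v ω ⬝ᵥ η := by
    simp only [dotProduct]
    fun_prop
  have hu_L2 : MemLp (fun ω => v ω ⬝ᵥ η) 2 μ := by
    simp only [dotProduct]
    exact memLp_finsetSum _ fun i _ => (hv_L2 i).mul_const (η i)
  have hu_int : Integrable (fun ω => v ω ⬝ᵥ η) μ := hu_L2.integrable one_le_two
  have hv_int : ∀ j, Integrable (fun ω => v ω j) μ := fun j => (hv_L2 j).integrable one_le_two
  have hu_mean : ∫ ω, v ω ⬝ᵥ η ∂μ = 0 := by
    simp only [dotProduct]
    rw [integral_finsetSum _ fun i _ => (hv_int i).mul_const (η i)]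
    simp [integral_mul_const, hv_mean]
  have ha : ∀ j, a j = 0 := fun j => by
    have hj := integral_congr_ae (hlin j)
    rw [integral_condExp hu.comap_le, hv_mean,
      integral_add (integrable_const _) (hu_int.mul_const _), integral_mul_const, hu_mean] at hj
    simpa using hj.symm
  have hcond : ∀ j, μ[(fun ω => v ω j - (v ω ⬝ᵥ η) * b j) |
      MeasurableSpace.comap (fun ω => v ω ⬝ᵥ η) Real.measurableSpace] =ᵐ[μ] 0 := fun j => by
    have hub : μ[(fun ω => (v ω ⬝ᵥ η) * b j) |
        MeasurableSpace.comap (fun ω => v ω ⬝ᵥ η) Real.measurableSpace] =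
        fun ω => (v ω ⬝ᵥ η) * b j :=
      condExp_of_stronglyMeasurable hu.comap_le
        ((comap_measurable fun ω => v ω ⬝ᵥ η).mul_const (b j)).stronglyMeasurable
        (hu_int.mul_const _)
    refine (condExp_sub (hv_int j) (hu_int.mul_const (b j)) _).trans ?_
    filter_upwards [hlin j] with ω hω
    simp [hω, hub, ha]
  have hr_int : ∀ j, Integrable (fun ω => v ω j - (v ω ⬝ᵥ η) * b j) μ := fun j =>
    (hv_int j).sub (hu_int.mul_const _)
  have hr_meas : ∀ j, Measurable fun ω => v ω j - (v ω ⬝ᵥ η) * b j := fun j =>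
    (hv_j j).sub (hu.mul_const _)
  have hproj : ∀ j (w : Ω → ℝ), MemLp w 2 μ →
      ∫ ω, (v ω j - (v ω ⬝ᵥ η) * b j) * w ω ∂μ = 0 →
      ∫ ω, v ω j * w ω ∂μ = (∫ ω, (v ω ⬝ᵥ η) * w ω ∂μ) * b j := fun j w hw hzero => by
    have hvw : Integrable (fun ω => v ω j * w ω) μ := (hv_L2 j).integrable_mul hw
    have huw : Integrable (fun ω => (v ω ⬝ᵥ η) * w ω) μ := hu_L2.integrable_mul hw
    rw [← integral_mul_const, ← sub_eq_zero, ← integral_sub hvw (huw.mul_const _), ← hzero]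
    congr 1 with ω
    ring
  have hvh : (fun j => ∫ ω, v ω j * h (Y ω) ∂μ) = (∫ ω, (v ω ⬝ᵥ η) * h (Y ω) ∂μ) • b := by
    ext j
    refine hproj j _ hhY ?_
    have hφ : Measurable fun x : Fin m → ℝ => (x j - (x ⬝ᵥ η) * b j, x ⬝ᵥ η) := by
      simp only [dotProduct]
      fun_prop
    have hind : IndepFun (fun ω => (v ω j - (v ω ⬝ᵥ η) * b j, v ω ⬝ᵥ η)) ε μ :=
      hindep.comp hφ measurable_id
    rw [hY]
    exact integral_mul_comp_noise_eq_zero_of_condExp_eq_zero (hr_meas j) (hr_int j) hu (hcond j)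
      hε_meas hind (hh.comp hg)
  have hMη : M *ᵥ η = (∫ ω, (v ω ⬝ᵥ η) * (v ω ⬝ᵥ η) ∂μ) • b := by
    ext j
    refine Eq.trans ?_ (hproj j _ hu_L2
      (integral_mul_comp_eq_zero_of_condExp_eq_zero (hr_int j) hu (hcond j) measurable_id))
    simp only [hM, mulVec, dotProduct, of_apply, Finset.mul_sum]
    rw [integral_finsetSum _ fun i _ => ?_]
    · refine Finset.sum_congr rfl fun i _ => ?_
      rw [← integral_mul_const]
      simp only [mul_assoc]
    · exact (hv_L2 j).integrable_mul ((hv_L2 i).mul_const (η i))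
  rw [hvh]
  by_cases hs : ∫ ω, (v ω ⬝ᵥ η) * (v ω ⬝ᵥ η) ∂μ = 0
  · have hu0 : (fun ω => (v ω ⬝ᵥ η) * (v ω ⬝ᵥ η)) =ᵐ[μ] 0 :=
      (integral_eq_zero_iff_of_nonneg (fun ω => mul_self_nonneg _)
        (hu_L2.integrable_mul hu_L2)).1 hs
    have huh : ∫ ω, (v ω ⬝ᵥ η) * h (Y ω) ∂μ = 0 := by
      refine integral_eq_zero_of_ae ?_
      filter_upwards [hu0] with ω hω
      simp [mul_self_eq_zero.1 hω]
    exact ⟨0, by simp [huh]⟩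
  · refine ⟨(∫ ω, (v ω ⬝ᵥ η) * h (Y ω) ∂μ) / ∫ ω, (v ω ⬝ᵥ η) * (v ω ⬝ᵥ η) ∂μ, ?_⟩
    have hη : η = (∫ ω, (v ω ⬝ᵥ η) * (v ω ⬝ᵥ η) ∂μ) • (M⁻¹ *ᵥ b) := by
      rw [← mulVec_smul, ← hMη, mulVec_mulVec, nonsing_inv_mul _ hM_inv, one_mulVec]
    conv_rhs => rw [div_eq_mul_inv, mul_smul]; arg 2; arg 2; rw [hη]
    rw [mulVec_smul, inv_smul_smul₀ hs]
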